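/- Suppose the metric measure space (X,d,m) satisfies (QRVD) and D⊂X is an Ahlfors regular subset with diam(D)>0. Then the metric measure space (D̄,d,m₀) satisfies (QRVD): there exist constants λ≥2 and C>1 such that m₀(B(x,λr)) ≥ C·m₀(B(x,r)) for every x∈D̄ and every r with d(x, D̄∖{x}) ≤ r < diam(D̄)/λ. -/

import Mathlib

open MeasureTheory Metric Set
open scoped ENNReal NNReal Topology

/-- A bound `c * m (ball x r) ≤ m (ball x r ∩ D)` valid for centres in `D` and small radii persists
for centres in the closure of `D`. -/
lemma mul_measure_ball_le_of_mem_closure {X : Type*} [PseudoMetricSpace X] [MeasurableSpace X]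
    {m : Measure X} {D : Set X} {c R : ℝ≥0∞}
    (h : ∀ x ∈ D, ∀ r : ℝ, 0 < r → ENNReal.ofReal r < R →
      c * m (ball x r) ≤ m (ball x r ∩ D))
    {x : X} (hx : x ∈ closure D) {r : ℝ} (hr : ENNReal.ofReal r < R) :
    c * m (ball x r) ≤ m (ball x r ∩ D) := by
  have hlt : ∀ s < r, c * m (ball x s) ≤ m (ball x r ∩ D) := by
    intro s hs
    rcases le_or_gt s 0 with hs0 | hs0
    · simp [ball_eq_empty.2 hs0]
    obtain ⟨y, hyD, hy⟩ := Metric.mem_closure_iff.1 hx ((r - s) / 2) (by linarith)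
    have h₁ : ball x s ⊆ ball y ((r + s) / 2) := ball_subset_ball' (by linarith)
    have h₂ : ball y ((r + s) / 2) ⊆ ball x r :=
      ball_subset_ball' (by rw [dist_comm]; linarith)
    calc c * m (ball x s) ≤ c * m (ball y ((r + s) / 2)) := by gcongr
      _ ≤ m (ball y ((r + s) / 2) ∩ D) :=
        h y hyD _ (by linarith) ((ENNReal.ofReal_le_ofReal (by linarith)).trans_lt hr)
      _ ≤ m (ball x r ∩ D) := by gcongr
  obtain ⟨u, hu_mono, hu_lt, hu_lim⟩ := exists_seq_strictMono_tendsto r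
  have hU : ball x r = ⋃ n, ball x (u n) := by
    refine Subset.antisymm (fun y hy => ?_) (iUnion_subset fun n => ball_subset_ball (hu_lt n).le)
    obtain ⟨n, hn⟩ := (hu_lim.eventually (lt_mem_nhds (mem_ball.1 hy))).exists
    exact mem_iUnion.2 ⟨n, hn⟩
  have hmono : Monotone fun n => ball x (u n) :=
    fun _ _ hij => ball_subset_ball (hu_mono.monotone hij)
  calc c * m (ball x r) = ⨆ n, c * m (ball x (u n)) := by
        rw [hU, hmono.measure_iUnion, ENNReal.mul_iSup]
    _ ≤ m (ball x r ∩ D) := iSup_le fun n => hlt _ (hu_lt n)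

/-- Iterating a reverse volume doubling inequality at scales `r, a * r, …, a ^ (k - 1) * r`. -/
lemma pow_mul_measure_ball_le {X : Type*} [PseudoMetricSpace X] [MeasurableSpace X]
    {m : Measure X} {x : X} {a r ρ : ℝ} {c R : ℝ≥0∞} (ha : 1 ≤ a) (hr : 0 ≤ r) (hρ : ρ ≤ r)
    (h : ∀ s : ℝ, ρ ≤ s → ENNReal.ofReal s < R / ENNReal.ofReal a →
      c * m (ball x s) ≤ m (ball x (a * s))) (k : ℕ)
    (hk : ENNReal.ofReal (a ^ k * r) < R) :
    c ^ k * m (ball x r) ≤ m (ball x (a ^ k * r)) := by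
  have ha0 : 0 < a := by linarith
  induction k with
  | zero => simp
  | succ k ih =>
    have hs : a ^ (k + 1) * r = a * (a ^ k * r) := by ring
    have hle : r ≤ a ^ k * r := le_mul_of_one_le_left hr (one_le_pow₀ ha)
    have hk' : ENNReal.ofReal (a ^ k * r) < R / ENNReal.ofReal a := by
      rw [ENNReal.lt_div_iff_mul_lt (.inl (by simpa using ha0)) (.inl ENNReal.ofReal_ne_top),
        ← ENNReal.ofReal_mul (by positivity), mul_comm, ← hs]
      exact hk
    have hkR : ENNReal.ofReal (a ^ k * r) < R := by
      refine (ENNReal.ofReal_le_ofReal ?_).trans_lt hk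
      rw [hs]
      exact le_mul_of_one_le_left (by positivity) ha
    calc c ^ (k + 1) * m (ball x r) = c * (c ^ k * m (ball x r)) := by ring
      _ ≤ c * m (ball x (a ^ k * r)) := by gcongr; exact ih hkR
      _ ≤ m (ball x (a * (a ^ k * r))) := h _ (hρ.trans hle) hk'
      _ = m (ball x (a ^ (k + 1) * r)) := by rw [hs]

theorem stmt_5
    {X : Type*} [MetricSpace X] [MeasurableSpace X] [BorelSpace X]
    [LocallyCompactSpace X] [TopologicalSpace.SeparableSpace X]
    (m : Measure X) [Measure.Regular m]
    (hfull : ∀ (x : X) (r : ℝ), 0 < r → 0 < m (ball x r))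
    (lam₀ C : ℝ) (hlam₀ : 2 ≤ lam₀) (hC : 1 < C)
    (hQRVD : ∀ (x : X) (r : ℝ), infDist x ({x}ᶜ : Set X) ≤ r →
      ENNReal.ofReal r < EMetric.diam (univ : Set X) / ENNReal.ofReal lam₀ →
      ENNReal.ofReal C * m (ball x r) ≤ m (ball x (lam₀ * r)))
    (D : Set X) (hDdiam : 0 < EMetric.diam D)
    (c_D : ℝ) (hc_D0 : 0 < c_D) (hc_D1 : c_D ≤ 1)
    (hAR : ∀ x ∈ D, ∀ r : ℝ, 0 < r → ENNReal.ofReal r < EMetric.diam D / 2 →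
      ENNReal.ofReal c_D * m (ball x r) ≤ m (ball x r ∩ D))
    :
    ∃ lam C' : ℝ, 2 ≤ lam ∧ 1 < C' ∧ ∀ x ∈ closure D, ∀ r : ℝ,
      infDist x (closure D \ {x}) ≤ r →
      ENNReal.ofReal r < EMetric.diam (closure D) / ENNReal.ofReal lam →
      ENNReal.ofReal C' * (m.restrict D) (ball x r)
        ≤ (m.restrict D) (ball x (lam * r)) := by
  obtain ⟨k, hk⟩ := pow_unbounded_of_one_lt c_D⁻¹ hC
  have hlam₁ : 1 ≤ lam₀ := by linarith
  have hlam_pos : 0 < lam₀ := by linarith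
  refine ⟨lam₀ ^ (k + 1), c_D * C ^ k, hlam₀.trans (le_self_pow₀ hlam₁ k.succ_ne_zero),
    (inv_lt_iff_one_lt_mul₀' hc_D0).1 hk, fun x hx r hxr hr => ?_⟩
  rcases le_or_gt r 0 with hr0 | hr0
  · simp [ball_eq_empty.2 hr0]
  have hscale : ENNReal.ofReal (lam₀ ^ k * r) < ediam D / 2 := by
    rw [ENNReal.lt_div_iff_mul_lt (.inl (by positivity)) (.inl ENNReal.ofReal_ne_top),
      ← ENNReal.ofReal_mul hr0.le] at hr
    replace hr := hr.trans_eq (ediam_closure D)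
    rw [ENNReal.lt_div_iff_mul_lt (.inl (by simp)) (.inl (by simp)),
      ← ENNReal.ofReal_ofNat 2, ← ENNReal.ofReal_mul (by positivity)]
    refine (ENNReal.ofReal_le_ofReal ?_).trans_lt hr
    calc lam₀ ^ k * r * 2 ≤ lam₀ ^ k * r * lam₀ := by gcongr
      _ = r * lam₀ ^ (k + 1) := by ring
  have hne : (closure D \ {x}).Nonempty := by
    obtain ⟨y, hy, hyx⟩ := (ediam_pos_iff.1 hDdiam).exists_ne x
    exact ⟨y, subset_closure hy, hyx⟩
  have hρ : infDist x ({x}ᶜ : Set X) ≤ r :=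
    (infDist_le_infDist_of_subset (fun _ hy => hy.2) hne).trans hxr
  have hdiam : ENNReal.ofReal (lam₀ ^ k * r) < ediam (univ : Set X) :=
    hscale.trans_le (ENNReal.half_le_self.trans (ediam_mono (subset_univ D)))
  rw [Measure.restrict_apply measurableSet_ball, Measure.restrict_apply measurableSet_ball]
  calc ENNReal.ofReal (c_D * C ^ k) * m (ball x r ∩ D)
      ≤ ENNReal.ofReal (c_D * C ^ k) * m (ball x r) := by gcongr; exact inter_subset_left
    _ = ENNReal.ofReal c_D * (ENNReal.ofReal C ^ k * m (ball x r)) := by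
        rw [ENNReal.ofReal_mul hc_D0.le, ENNReal.ofReal_pow (by linarith), mul_assoc]
    _ ≤ ENNReal.ofReal c_D * m (ball x (lam₀ ^ k * r)) := by
        gcongr
        exact pow_mul_measure_ball_le hlam₁ hr0.le hρ (hQRVD x) k hdiam
    _ ≤ m (ball x (lam₀ ^ k * r) ∩ D) := mul_measure_ball_le_of_mem_closure hAR hx hscale
    _ ≤ m (ball x (lam₀ ^ (k + 1) * r) ∩ D) := by
        gcongr
        exact k.le_succ
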